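/- In the symmetric group on the 16 points {0,1,…,15}, let σ₁ = (0,1)(2,7,9,11,13,4,14,3,6,8,10,12,5,15) and σ₂ = (0,15,8,11,14,1,6,5)(2,3,10,7,12,13,4,9). Then the subgroup G_𝒞 of Sym(16) generated by σ₁ and σ₂ has order 322560 = 2¹⁰·3²·5·7, and the binary code 𝒞₁₆ ⊆ 𝔽₂¹⁶ is invariant under G_𝒞: for every codeword x ∈ 𝒞₁₆ and every g ∈ G_𝒞, the vector obtained by permuting the coordinates of x by g again lies in 𝒞₁₆. -/

import Mathlib

/-- The generators of the binary code `𝒞₁₆`. -/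
def C16gens : Fin 11 → Fin 16 → ZMod 2 :=
  ![![1,0,0,0,0,0,0,1,0,0,0,1,0,1,1,1],
    ![0,1,0,0,0,0,0,1,0,0,0,1,0,1,0,0],
    ![0,0,1,0,0,0,0,1,0,0,0,1,0,0,1,0],
    ![0,0,0,1,0,0,0,1,0,0,0,1,0,0,0,1],
    ![0,0,0,0,1,0,0,1,0,0,0,0,0,1,1,0],
    ![0,0,0,0,0,1,0,1,0,0,0,0,0,1,0,1],
    ![0,0,0,0,0,0,1,1,0,0,0,0,0,0,1,1],
    ![0,0,0,0,0,0,0,0,1,0,0,1,0,1,1,0],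
    ![0,0,0,0,0,0,0,0,0,1,0,1,0,1,0,1],
    ![0,0,0,0,0,0,0,0,0,0,1,1,0,0,1,1],
    ![0,0,0,0,0,0,0,0,0,0,0,0,1,1,1,1]]

/-- The permutation `(0,1)(2,7,9,11,13,4,14,3,6,8,10,12,5,15)` on `{0,…,15}`. -/
def permσ₁ : Equiv.Perm (Fin 16) :=
  ([0,1] : List (Fin 16)).formPerm *
    ([2,7,9,11,13,4,14,3,6,8,10,12,5,15] : List (Fin 16)).formPerm

/-- The permutation `(0,15,8,11,14,1,6,5)(2,3,10,7,12,13,4,9)` on `{0,…,15}`. -/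
def permσ₂ : Equiv.Perm (Fin 16) :=
  ([0,15,8,11,14,1,6,5] : List (Fin 16)).formPerm *
    ([2,3,10,7,12,13,4,9] : List (Fin 16)).formPerm

/-- The subgroup of permutations preserving the affine structure `x + y + z` of `𝔽₂⁴`, where the
points `0, …, 15` are identified with vectors through their binary digits. -/
def affinePerms : Subgroup (Equiv.Perm (Fin 16)) where
  carrier := {g | ∀ a b c, g (a ^^^ b ^^^ c) = g a ^^^ g b ^^^ g c}
  mul_mem' {g h} hg hh a b c := by
    simp only [Equiv.Perm.mul_apply, hh a b c, hg (h a) (h b) (h c)]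
  one_mem' _ _ _ := rfl
  inv_mem' {g} hg a b c := by
    rw [Equiv.Perm.inv_eq_iff_eq, hg]
    simp

theorem mem_affinePerms {g : Equiv.Perm (Fin 16)} :
    g ∈ affinePerms ↔ ∀ a b c, g (a ^^^ b ^^^ c) = g a ^^^ g b ^^^ g c :=
  Iff.rfl

/-- The group generated by `permσ₁` and `permσ₂`. -/
def codeGroup : Subgroup (Equiv.Perm (Fin 16)) :=
  Subgroup.closure {permσ₁, permσ₂}

theorem permσ₁_mem_codeGroup : permσ₁ ∈ codeGroup :=
  Subgroup.subset_closure (by simp)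

theorem permσ₂_mem_codeGroup : permσ₂ ∈ codeGroup :=
  Subgroup.subset_closure (by simp)

theorem permσ₁_mem_affinePerms : permσ₁ ∈ affinePerms := by
  rw [mem_affinePerms]
  decide +kernel

theorem permσ₂_mem_affinePerms : permσ₂ ∈ affinePerms := by
  rw [mem_affinePerms]
  decide +kernel

theorem codeGroup_le_affinePerms : codeGroup ≤ affinePerms := by
  rw [codeGroup, Subgroup.closure_le]
  rintro g (rfl | rfl)
  exacts [permσ₁_mem_affinePerms, permσ₂_mem_affinePerms]

/-- The product of the permutations `permσ₁ ^ a * permσ₂ ^ b` over the pairs `(a, b)` in `w`. -/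
def wordPerm (w : List (ℕ × ℕ)) : Equiv.Perm (Fin 16) :=
  (w.map fun e => permσ₁ ^ e.1 * permσ₂ ^ e.2).prod

theorem wordPerm_mem_codeGroup (w : List (ℕ × ℕ)) : wordPerm w ∈ codeGroup := by
  refine Subgroup.list_prod_mem _ fun g hg => ?_
  obtain ⟨e, -, rfl⟩ := List.mem_map.1 hg
  exact mul_mem (pow_mem permσ₁_mem_codeGroup _) (pow_mem permσ₂_mem_codeGroup _)

/-- The elements of `codeGroup` fixing each of the points `0, …, n - 1`. -/
def codeGroupFixing (n : ℕ) : Subgroup (Equiv.Perm (Fin 16)) :=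
  codeGroup ⊓ fixingSubgroup (Equiv.Perm (Fin 16)) {x : Fin 16 | x.val < n}

theorem mem_codeGroupFixing {n : ℕ} {g : Equiv.Perm (Fin 16)} :
    g ∈ codeGroupFixing n ↔ g ∈ codeGroup ∧ ∀ x : Fin 16, x.val < n → g x = x := by
  simp [codeGroupFixing, mem_fixingSubgroup_iff]

theorem wordPerm_mem_codeGroupFixing {n : ℕ} {w : List (ℕ × ℕ)}
    (h : ∀ x : Fin 16, x.val < n → wordPerm w x = x) : wordPerm w ∈ codeGroupFixing n :=
  mem_codeGroupFixing.2 ⟨wordPerm_mem_codeGroup w, h⟩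

/-- The orbit-stabilizer theorem for a subgroup of a finite permutation group. -/
theorem Subgroup.card_eq_card_orbit_mul_card_inf_stabilizer {α : Type*} [Finite α]
    (H : Subgroup (Equiv.Perm α)) (a : α) :
    Nat.card H = (MulAction.orbit H a).ncard *
      Nat.card ↥(H ⊓ MulAction.stabilizer (Equiv.Perm α) a) := by
  have hstab : MulAction.stabilizer H a =
      (H ⊓ MulAction.stabilizer (Equiv.Perm α) a).subgroupOf H := by
    ext g
    simp [Subgroup.mem_subgroupOf, Subgroup.smul_def]
  rw [← Nat.card_congr (Subgroup.subgroupOfEquivOfLe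
    (inf_le_left : H ⊓ MulAction.stabilizer (Equiv.Perm α) a ≤ H)).toEquiv, ← hstab,
    ← MulAction.index_stabilizer, mul_comm, Subgroup.card_mul_index]

/-- The index of consecutive terms of the stabilizer chain, given that the points up to `m`
generate those below `n` and that the points from `m` on lie in a single orbit. -/
theorem card_codeGroupFixing {m : Fin 16} {n : ℕ} (hmn : m.val < n)
    (hgen : ∀ x : Fin 16, x.val < n → x ≤ m ∨ ∃ y < m, x = 0 ^^^ m ^^^ y)
    (horb : ∀ x, m ≤ x → ∃ g ∈ codeGroupFixing m, g m = x) :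
    Nat.card (codeGroupFixing m) = (16 - m) * Nat.card (codeGroupFixing n) := by
  have hstab : codeGroupFixing m ⊓ MulAction.stabilizer (Equiv.Perm (Fin 16)) m =
      codeGroupFixing n := by
    ext g
    simp only [Subgroup.mem_inf, mem_codeGroupFixing, MulAction.mem_stabilizer_iff,
      Equiv.Perm.smul_def]
    constructor
    · rintro ⟨⟨hg, hfix⟩, hm⟩
      have hle : ∀ x ≤ m, g x = x := fun x hx => by
        rcases hx.lt_or_eq with h | rfl
        exacts [hfix x h, hm]
      refine ⟨hg, fun x hx => ?_⟩
      rcases hgen x hx with h | ⟨y, hy, rfl⟩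
      · exact hle x h
      · rw [mem_affinePerms.1 (codeGroup_le_affinePerms hg), hle 0 (Fin.zero_le m), hm,
          hfix y hy]
    · rintro ⟨hg, hfix⟩
      exact ⟨⟨hg, fun x hx => hfix x (hx.trans hmn)⟩, hfix m hmn⟩
  have horbit : MulAction.orbit (codeGroupFixing m) m = (Finset.Ici m : Finset (Fin 16)) := by
    ext x
    simp only [MulAction.mem_orbit_iff, Subtype.exists, Subgroup.mk_smul, Equiv.Perm.smul_def,
      Finset.coe_Ici, Set.mem_Ici, exists_prop]
    refine ⟨?_, horb x⟩
    rintro ⟨g, hg, rfl⟩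
    by_contra! hlt
    exact hlt.ne (g.injective ((mem_codeGroupFixing.1 hg).2 _ hlt))
  rw [Subgroup.card_eq_card_orbit_mul_card_inf_stabilizer _ m, hstab, horbit,
    Set.ncard_coe_finset, Fin.card_Ici]

theorem card_codeGroupFixing_zero :
    Nat.card (codeGroupFixing 0) = 16 * Nat.card (codeGroupFixing 1) := by
  refine card_codeGroupFixing (m := 0) (by decide) (by decide) fun x _ => ?_
  obtain ⟨i, j, h⟩ : ∃ i j : Fin 14, wordPerm [(i, j)] 0 = x := by
    revert x
    decide +kernel
  exact ⟨_, wordPerm_mem_codeGroupFixing (by simp), h⟩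

theorem card_codeGroupFixing_one :
    Nat.card (codeGroupFixing 1) = 15 * Nat.card (codeGroupFixing 2) := by
  refine card_codeGroupFixing (m := 1) (by decide) (by decide) fun x hx => ?_
  have hg : wordPerm [(9, 5)] ∈ codeGroupFixing 1 :=
    wordPerm_mem_codeGroupFixing (by decide +kernel)
  obtain ⟨i, h⟩ : ∃ i : Fin 15, (wordPerm [(9, 5)] ^ i.val) 1 = x := by
    revert x
    decide +kernel
  exact ⟨_, pow_mem hg _, h⟩

theorem card_codeGroupFixing_two :
    Nat.card (codeGroupFixing 2) = 14 * Nat.card (codeGroupFixing 4) := by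
  refine card_codeGroupFixing (m := 2) (by decide) (by decide) fun x hx => ?_
  have hg : wordPerm [(2, 0)] ∈ codeGroupFixing 2 :=
    wordPerm_mem_codeGroupFixing (by decide +kernel)
  have hh : wordPerm [(0, 2), (9, 1)] ∈ codeGroupFixing 2 :=
    wordPerm_mem_codeGroupFixing (by decide +kernel)
  obtain ⟨i, j, h⟩ : ∃ i j : Fin 7,
      (wordPerm [(2, 0)] ^ i.val * wordPerm [(0, 2), (9, 1)] ^ j.val) 2 = x := by
    revert x
    decide +kernel
  exact ⟨_, mul_mem (pow_mem hg _) (pow_mem hh _), h⟩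

theorem card_codeGroupFixing_four :
    Nat.card (codeGroupFixing 4) = 12 * Nat.card (codeGroupFixing 8) := by
  refine card_codeGroupFixing (m := 4) (by decide) (by decide) fun x hx => ?_
  have hg : wordPerm [(3, 7), (5, 6), (3, 0)] ∈ codeGroupFixing 4 :=
    wordPerm_mem_codeGroupFixing (by decide +kernel)
  have hh : wordPerm [(9, 2), (9, 1), (5, 0)] ∈ codeGroupFixing 4 :=
    wordPerm_mem_codeGroupFixing (by decide +kernel)
  obtain ⟨i, j, h⟩ : ∃ i j : Fin 6,
      (wordPerm [(3, 7), (5, 6), (3, 0)] ^ i.val *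
        wordPerm [(9, 2), (9, 1), (5, 0)] ^ j.val) 4 = x := by
    revert x
    decide +kernel
  exact ⟨_, mul_mem (pow_mem hg _) (pow_mem hh _), h⟩

theorem card_codeGroupFixing_eight :
    Nat.card (codeGroupFixing 8) = 8 * Nat.card (codeGroupFixing 16) := by
  refine card_codeGroupFixing (m := 8) (by decide) (by decide) fun x hx => ?_
  have hg : wordPerm [(0, 2), (9, 3), (9, 1)] ∈ codeGroupFixing 8 :=
    wordPerm_mem_codeGroupFixing (by decide +kernel)
  have hh : wordPerm [(1, 3), (3, 1), (4, 1), (2, 0)] ∈ codeGroupFixing 8 :=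
    wordPerm_mem_codeGroupFixing (by decide +kernel)
  have hk : wordPerm [(4, 1), (2, 6), (3, 1), (1, 0)] ∈ codeGroupFixing 8 :=
    wordPerm_mem_codeGroupFixing (by decide +kernel)
  obtain ⟨i, j, k, h⟩ : ∃ i j k : Fin 2,
      (wordPerm [(0, 2), (9, 3), (9, 1)] ^ i.val *
        wordPerm [(1, 3), (3, 1), (4, 1), (2, 0)] ^ j.val *
        wordPerm [(4, 1), (2, 6), (3, 1), (1, 0)] ^ k.val) 8 = x := by
    revert x
    decide +kernel
  exact ⟨_, mul_mem (mul_mem (pow_mem hg _) (pow_mem hh _)) (pow_mem hk _), h⟩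

theorem codeGroupFixing_sixteen : codeGroupFixing 16 = ⊥ := by
  rw [eq_bot_iff]
  exact fun g hg => Equiv.ext fun x => (mem_codeGroupFixing.1 hg).2 x x.isLt

theorem card_codeGroup : Nat.card codeGroup = 322560 := by
  have h : codeGroup = codeGroupFixing 0 := by
    ext g
    simp [mem_codeGroupFixing]
  rw [h, card_codeGroupFixing_zero, card_codeGroupFixing_one, card_codeGroupFixing_two,
    card_codeGroupFixing_four, card_codeGroupFixing_eight, codeGroupFixing_sixteen,
    Subgroup.card_bot]

/-- The information positions (pivot columns) of the reduced generators `C16gens`. -/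
def C16pivot : Fin 11 → Fin 16 :=
  ![0, 1, 2, 3, 4, 5, 6, 8, 9, 10, 12]

theorem mem_span_C16gens_of_eq_sum {x : Fin 16 → ZMod 2}
    (h : ∀ i, x i = ∑ k, x (C16pivot k) * C16gens k i) :
    x ∈ Submodule.span (ZMod 2) (Set.range C16gens) := by
  have hx : x = ∑ k, x (C16pivot k) • C16gens k := by
    ext i
    simpa using h i
  rw [hx]
  exact Submodule.sum_mem _ fun k _ =>
    Submodule.smul_mem _ _ (Submodule.subset_span (Set.mem_range_self k))

theorem comp_mem_span_C16gens {g : Equiv.Perm (Fin 16)}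
    (hg : ∀ k, C16gens k ∘ g ∈ Submodule.span (ZMod 2) (Set.range C16gens))
    {x : Fin 16 → ZMod 2} (hx : x ∈ Submodule.span (ZMod 2) (Set.range C16gens)) :
    x ∘ g ∈ Submodule.span (ZMod 2) (Set.range C16gens) := by
  have hle : Submodule.span (ZMod 2) (Set.range C16gens) ≤
      (Submodule.span (ZMod 2) (Set.range C16gens)).comap
        (LinearMap.funLeft (ZMod 2) (ZMod 2) g) := by
    rw [Submodule.span_le]
    rintro _ ⟨k, rfl⟩
    exact hg k
  exact hle hx

theorem comp_mem_span_C16gens_of_mem_codeGroup {g : Equiv.Perm (Fin 16)} (hg : g ∈ codeGroup)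
    {x : Fin 16 → ZMod 2} (hx : x ∈ Submodule.span (ZMod 2) (Set.range C16gens)) :
    x ∘ g ∈ Submodule.span (ZMod 2) (Set.range C16gens) := by
  induction hg using Subgroup.closure_induction'' generalizing x with
  | mem g hg =>
    refine comp_mem_span_C16gens (fun k => mem_span_C16gens_of_eq_sum ?_) hx
    rcases hg with rfl | rfl <;> revert k <;> decide +kernel
  | inv_mem g hg =>
    refine comp_mem_span_C16gens (fun k => mem_span_C16gens_of_eq_sum ?_) hx
    rcases hg with rfl | rfl <;> revert k <;> decide +kernel
  | one => exact hx
  | mul g h _ _ ihg ihh => exact ihh (ihg hx)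

theorem stmt_16 :
    let G : Subgroup (Equiv.Perm (Fin 16)) := Subgroup.closure {permσ₁, permσ₂}
    let C : Submodule (ZMod 2) (Fin 16 → ZMod 2) :=
      Submodule.span (ZMod 2) (Set.range C16gens)
    Nat.card G = 322560 ∧
    ∀ x ∈ C, ∀ g ∈ G, (fun i => x (g⁻¹ i)) ∈ C := by
  exact ⟨card_codeGroup, fun _ hx _ hg =>
    comp_mem_span_C16gens_of_mem_codeGroup (inv_mem hg) hx⟩
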